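/- Let p > 3, (p+1)/2 < q < p, μ ∈ ℝ, 1/(q−1) < β < 2/(p−1), 0 < ε < min(1, (p−1)/4), K₀ ≥ 1; set γ = (p−q)/(p−1) > 0. For every A ≥ 1 there exist s₅ ≥ 1 and C > 0 such that the following holds for all s ≥ s₅: if v : ℝ → ℝ is a C¹ function satisfying sup_y (1+|y|^β)|v(y)| ≤ A² s^{−(1−β)/2}, sup_y |v′(y)| ≤ A² s^{−1/2}, and sup_y (1+|y|^β)|v′(y)| ≤ A² s^{−(1−β)/2}, then the function N(y,s) = μ e^{−γs} |v′(y) + ∂_y φ(y,s)| ∫_{−|y|}^{|y|} |v(y′) + φ(y′,s)|^{q−1} dy′ satisfies: (i) |N_m(s)| ≤ C e^{−γ s/2} for m = 0, 1, 2, where N_m(s) = ∫_ℝ N(y,s) k_m(y) ρ(y) dy; and (ii) |N_-(y,s)| ≤ C e^{−γ s/2} (1 + |y|³) for all y ∈ ℝ, where N_-(y,s) = χ(y,s) N(y,s) − Σ_{m=0}^{2} N_m(s) h_m(y) and χ(y,s) = χ₀(|y|/(K₀√s)). -/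

import Mathlib

open MeasureTheory Real intervalIntegral

/-- The one-dimensional profile `φ(y,s) = f(y/√s) + (κ/(2ps)) χ₀(y/g_ε(s))`, where
`f(z) = (p-1+bz²)^{-1/(p-1)}`, `b = (p-1)²/(4p)`, `κ = (p-1)^{-1/(p-1)}`,
`g_ε(s) = s^{1/2+ε}`. -/
noncomputable def phi1 (p ε : ℝ) (χ₀ : ℝ → ℝ) (s y : ℝ) : ℝ :=
  (p - 1 + (p - 1) ^ 2 / (4 * p) * (y / Real.sqrt s) ^ 2) ^ (-(1 / (p - 1))) +
    (p - 1) ^ (-(1 / (p - 1))) / (2 * p * s) * χ₀ (y / s ^ (1 / 2 + ε))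

/-- The new term
`N(y,s) = μ e^{-γs} |v'(y) + ∂_yφ(y,s)| ∫_{-|y|}^{|y|} |v(y') + φ(y',s)|^{q-1} dy'`,
with `γ = (p-q)/(p-1)`. -/
noncomputable def Nterm (p q μ ε : ℝ) (χ₀ : ℝ → ℝ) (v : ℝ → ℝ) (s y : ℝ) : ℝ :=
  μ * Real.exp (-((p - q) / (p - 1)) * s) *
    |deriv v y + deriv (phi1 p ε χ₀ s) y| *
    ∫ y' in (-|y|)..(|y|), |v y' + phi1 p ε χ₀ s y'| ^ (q - 1)

/-- The rescaled Hermite polynomials `h₀ = 1`, `h₁ = y`, `h₂ = y² - 2`. -/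
noncomputable def hpoly : ℕ → ℝ → ℝ
  | 0, _ => 1
  | 1, y => y
  | 2, y => y ^ 2 - 2
  | _, _ => 0

/-- `k_m = h_m / ∫ h_m² ρ = h_m / (2^m m!)`. -/
noncomputable def kpoly (m : ℕ) (y : ℝ) : ℝ := hpoly m y / (2 ^ m * Nat.factorial m)

/-- The Gaussian weight `ρ(y) = e^{-y²/4}/√(4π)`. -/
noncomputable def rhoW (y : ℝ) : ℝ := Real.exp (-y ^ 2 / 4) / Real.sqrt (4 * Real.pi)

/-- The projection `N_m(s) = ∫ N(y,s) k_m(y) ρ(y) dy`. -/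
noncomputable def NtermProj (p q μ ε : ℝ) (χ₀ : ℝ → ℝ) (v : ℝ → ℝ) (s : ℝ) (m : ℕ) : ℝ :=
  ∫ y : ℝ, Nterm p q μ ε χ₀ v s y * kpoly m y * rhoW y

/-- `N_-(y,s) = χ(y,s) N(y,s) - Σ_{m=0}^{2} N_m(s) h_m(y)`, `χ(y,s) = χ₀(|y|/(K₀√s))`. -/
noncomputable def NtermMinus (p q μ ε K₀ : ℝ) (χ₀ : ℝ → ℝ) (v : ℝ → ℝ) (s y : ℝ) : ℝ :=
  χ₀ (|y| / (K₀ * Real.sqrt s)) * Nterm p q μ ε χ₀ v s y -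
    ∑ m ∈ Finset.range 3, NtermProj p q μ ε χ₀ v s m * hpoly m y

/-- A smooth function supported in `[-2, 2]` has bounded derivative. -/
lemma exists_deriv_bound_of_support {χ₀ : ℝ → ℝ} (hχ : ContDiff ℝ (⊤ : ℕ∞) χ₀)
    (hsupp : Function.support χ₀ ⊆ Set.Icc (-2 : ℝ) 2) :
    ∃ B, 0 ≤ B ∧ ∀ z, |deriv χ₀ z| ≤ B := by
  have hc : HasCompactSupport χ₀ :=
    HasCompactSupport.of_support_subset_isCompact isCompact_Icc hsupp
  obtain ⟨B, hB⟩ := (hc.deriv).exists_bound_of_continuous (hχ.continuous_deriv (by simp))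
  exact ⟨B, (norm_nonneg _).trans (hB 0), hB⟩

/-- The derivative of the stationary profile `f(z) = (p - 1 + b z²)^{-e}`. -/
lemma hasDerivAt_profile {a b : ℝ} (ha : 0 < a) (hb : 0 ≤ b) (e r y : ℝ) :
    HasDerivAt (fun y => (a + b * (y / r) ^ 2) ^ (-e))
      (b * (2 * (y / r) * (1 / r)) * -e * (a + b * (y / r) ^ 2) ^ (-e - 1)) y := by
  have h1 : HasDerivAt (fun y : ℝ => a + b * (y / r) ^ 2) (b * (2 * (y / r) * (1 / r))) y := by
    have := ((((hasDerivAt_id y).div_const r).pow 2).const_mul b).const_add a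
    simpa using this
  exact h1.rpow_const (Or.inl (by positivity))

lemma profile_le {a b : ℝ} (ha : 0 < a) (hb : 0 ≤ b) {e : ℝ} (he : 0 ≤ e) (z : ℝ) :
    (a + b * z ^ 2) ^ (-e) ≤ a ^ (-e) :=
  Real.rpow_le_rpow_of_nonpos ha (by nlinarith [mul_nonneg hb (sq_nonneg z)]) (by linarith)

lemma abs_deriv_profile_le {a b : ℝ} (ha : 0 < a) (hb : 0 ≤ b) {e r : ℝ} (he : 0 ≤ e)
    (hr : 1 ≤ r) (y : ℝ) :
    |b * (2 * (y / r) * (1 / r)) * -e * (a + b * (y / r) ^ 2) ^ (-e - 1)| ≤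
      e * a ^ (-e) * (b / a + 1) := by
  generalize y / r = z
  have hD : 0 < a + b * z ^ 2 := by positivity
  have hr0 : 0 < r := by linarith
  have hr1 : 1 / r ≤ 1 := by rw [div_le_one hr0]; exact hr
  have hz : b * (2 * |z|) / (a + b * z ^ 2) ≤ b / a + 1 := by
    rw [div_le_iff₀ hD]
    have h1 : b * (2 * |z|) ≤ b + b * z ^ 2 := by
      nlinarith [mul_nonneg hb (sq_nonneg (|z| - 1)), sq_abs z]
    have h2 : b / a * a = b := by field_simp
    have h3 : 0 ≤ b / a * (b * z ^ 2) := by positivity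
    nlinarith
  have hP := profile_le ha hb he z
  rw [Real.rpow_sub_one hD.ne', abs_mul, abs_mul, abs_mul, abs_mul, abs_mul, abs_neg,
    abs_of_nonneg hb, abs_of_nonneg he, abs_of_pos (by positivity : 0 < 1 / r), abs_div,
    abs_of_pos hD, abs_of_pos (by positivity : (0 : ℝ) < (a + b * z ^ 2) ^ (-e)),
    abs_of_pos (two_pos : (0 : ℝ) < 2)]
  calc b * (2 * |z| * (1 / r)) * e * ((a + b * z ^ 2) ^ (-e) / (a + b * z ^ 2))
      = e * (a + b * z ^ 2) ^ (-e) * (b * (2 * |z|) / (a + b * z ^ 2)) * (1 / r) := by ring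
    _ ≤ e * a ^ (-e) * (b / a + 1) * 1 := by gcongr
    _ = _ := mul_one _

/-- The profile is bounded uniformly in `s ≥ 1`, together with its space derivative. -/
lemma exists_phi1_bound {p ε : ℝ} (hp : 3 < p) (hε0 : 0 < ε) {χ₀ : ℝ → ℝ}
    (hχ : ContDiff ℝ (⊤ : ℕ∞) χ₀) (hχ01 : ∀ z, 0 ≤ χ₀ z ∧ χ₀ z ≤ 1)
    (hχsupp : Function.support χ₀ ⊆ Set.Icc (-2 : ℝ) 2) :
    ∃ M, 0 ≤ M ∧ ∀ s ≥ (1 : ℝ), ∀ y,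
      |phi1 p ε χ₀ s y| ≤ M ∧ |deriv (phi1 p ε χ₀ s) y| ≤ M := by
  obtain ⟨B, hB0, hB⟩ := exists_deriv_bound_of_support hχ hχsupp
  have ha : 0 < p - 1 := by linarith
  have hb : 0 ≤ (p - 1) ^ 2 / (4 * p) := by positivity
  have he : 0 ≤ 1 / (p - 1) := by positivity
  set b := (p - 1) ^ 2 / (4 * p)
  set e := 1 / (p - 1)
  set κ := (p - 1) ^ (-e)
  have hκ : 0 ≤ κ := by positivity
  have hL : 0 ≤ e * κ * (b / (p - 1) + 1) := by positivity
  refine ⟨(κ + κ) + (e * κ * (b / (p - 1) + 1) + κ * B), by positivity, fun s hs y => ?_⟩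
  have hs0 : 0 < s := by linarith
  have hcoef : κ / (2 * p * s) ≤ κ := div_le_self hκ (by nlinarith)
  have hcoef0 : 0 ≤ κ / (2 * p * s) := by positivity
  have hg : 1 ≤ s ^ (1 / 2 + ε) := Real.one_le_rpow hs (by linarith)
  constructor
  · have h1 := profile_le ha hb he (y / √s)
    have h0 : 0 ≤ (p - 1 + b * (y / √s) ^ 2) ^ (-e) := by positivity
    have h2 : κ / (2 * p * s) * χ₀ (y / s ^ (1 / 2 + ε)) ≤ κ * 1 :=
      mul_le_mul hcoef (hχ01 _).2 (hχ01 _).1 hκ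
    have h3 := mul_nonneg hcoef0 (hχ01 (y / s ^ (1 / 2 + ε))).1
    have h4 := mul_nonneg hκ hB0
    change |(p - 1 + b * (y / √s) ^ 2) ^ (-e)
      + κ / (2 * p * s) * χ₀ (y / s ^ (1 / 2 + ε))| ≤ _
    rw [abs_of_nonneg (by linarith)]
    linarith
  · have hd1 := hasDerivAt_profile ha hb e (√s) y
    have hd2 : HasDerivAt (fun y => χ₀ (y / s ^ (1 / 2 + ε)))
        (deriv χ₀ (y / s ^ (1 / 2 + ε)) * (1 / s ^ (1 / 2 + ε))) y :=
      HasDerivAt.comp y ((hχ.differentiable (by simp)) _).hasDerivAt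
        ((hasDerivAt_id y).div_const _)
    have hd : HasDerivAt (phi1 p ε χ₀ s) _ y := hd1.add (hd2.const_mul (κ / (2 * p * s)))
    rw [hd.deriv]
    have h1 := abs_deriv_profile_le ha hb he (Real.one_le_sqrt.mpr hs) y
    have h2 : |κ / (2 * p * s) *
        (deriv χ₀ (y / s ^ (1 / 2 + ε)) * (1 / s ^ (1 / 2 + ε)))| ≤ κ * (B * 1) := by
      rw [abs_mul, abs_mul, abs_of_nonneg hcoef0,
        abs_of_pos (by positivity : 0 < 1 / s ^ (1 / 2 + ε))]
      have : 1 / s ^ (1 / 2 + ε) ≤ 1 := by rw [div_le_one (by linarith)]; exact hg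
      gcongr
      exact hB _
    refine (abs_add_le _ _).trans ?_
    linarith

/-- If `v + φ` and its derivative are bounded, the nonlinear term grows at most linearly. -/
lemma abs_Nterm_le {p q μ ε : ℝ} {χ₀ v : ℝ → ℝ} {s R : ℝ} (hq : 1 ≤ q)
    (hv : ∀ y, |v y + phi1 p ε χ₀ s y| ≤ R)
    (hdv : ∀ y, |deriv v y + deriv (phi1 p ε χ₀ s) y| ≤ R) (y : ℝ) :
    |Nterm p q μ ε χ₀ v s y| ≤
      (|μ| * R * R ^ (q - 1) * 2) * Real.exp (-((p - q) / (p - 1)) * s) * |y| := by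
  have hR : 0 ≤ R := (abs_nonneg _).trans (hv 0)
  have hI : |∫ y' in (-|y|)..(|y|), |v y' + phi1 p ε χ₀ s y'| ^ (q - 1)| ≤
      R ^ (q - 1) * (2 * |y|) := by
    have := intervalIntegral.norm_integral_le_of_norm_le_const (a := -|y|) (b := |y|)
      (f := fun y' => |v y' + phi1 p ε χ₀ s y'| ^ (q - 1)) (C := R ^ (q - 1))
      (fun x _ => by
        rw [Real.norm_eq_abs, abs_of_nonneg (by positivity)]
        exact Real.rpow_le_rpow (abs_nonneg _) (hv x) (by linarith))
    rwa [Real.norm_eq_abs, sub_neg_eq_add, ← two_mul,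
      abs_of_nonneg (by positivity : 0 ≤ 2 * |y|)] at this
  rw [Nterm, abs_mul, abs_mul, abs_mul, abs_abs, Real.abs_exp]
  calc _ ≤ |μ| * Real.exp (-((p - q) / (p - 1)) * s) * R * (R ^ (q - 1) * (2 * |y|)) := by
        gcongr
        exact hdv y
    _ = _ := by ring

lemma abs_hpoly_le (m : ℕ) (y : ℝ) : |hpoly m y| ≤ y ^ 2 + 2 := by
  rcases m with _ | _ | _ | m <;> simp only [hpoly] <;> rw [abs_le] <;> constructor <;>
    nlinarith [sq_nonneg (y - 1), sq_nonneg (y + 1)]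

lemma abs_kpoly_le (m : ℕ) (y : ℝ) : |kpoly m y| ≤ y ^ 2 + 2 := by
  have h1 : (1 : ℝ) ≤ 2 ^ m * Nat.factorial m := by
    exact_mod_cast Nat.one_le_iff_ne_zero.mpr (by positivity)
  rw [kpoly, abs_div, abs_of_pos (by positivity : (0 : ℝ) < 2 ^ m * Nat.factorial m)]
  exact (div_le_self (abs_nonneg _) h1).trans (abs_hpoly_le m y)

lemma rhoW_nonneg (y : ℝ) : 0 ≤ rhoW y := by unfold rhoW; positivity

lemma integrable_sq_add_two_sq_mul_rhoW :
    Integrable (fun y : ℝ => (y ^ 2 + 2) ^ 2 * rhoW y) := by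
  have h (n : ℕ) : Integrable (fun y : ℝ => y ^ n * Real.exp (-(1 / 4) * y ^ 2)) := by
    simpa using integrable_rpow_mul_exp_neg_mul_sq (b := 1 / 4) (by norm_num)
      (s := (n : ℝ)) (by linarith [n.cast_nonneg (α := ℝ)])
  have h' := (((h 4).add ((h 2).const_mul 4)).add ((h 0).const_mul 4)).div_const
    (√(4 * Real.pi))
  refine h'.congr (Filter.Eventually.of_forall fun y => ?_)
  simp only [Pi.add_apply, rhoW]
  rw [show -y ^ 2 / 4 = -(1 / 4) * y ^ 2 by ring]
  ring

/-- Linear growth of the nonlinear term controls its Hermite projections. -/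
lemma abs_NtermProj_le {p q μ ε : ℝ} {χ₀ v : ℝ → ℝ} {s K : ℝ} (hK : 0 ≤ K)
    (hN : ∀ y, |Nterm p q μ ε χ₀ v s y| ≤ K * |y|) (m : ℕ) :
    |NtermProj p q μ ε χ₀ v s m| ≤ K * ∫ y : ℝ, (y ^ 2 + 2) ^ 2 * rhoW y := by
  rw [NtermProj, ← MeasureTheory.integral_const_mul, ← Real.norm_eq_abs]
  refine MeasureTheory.norm_integral_le_of_norm_le (integrable_sq_add_two_sq_mul_rhoW.const_mul K)
    (Filter.Eventually.of_forall fun y => ?_)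
  have hy : |y| ≤ y ^ 2 + 2 := abs_hpoly_le 1 y
  have hρ := rhoW_nonneg y
  rw [Real.norm_eq_abs, abs_mul, abs_mul, abs_of_nonneg hρ]
  calc _ ≤ K * (y ^ 2 + 2) * (y ^ 2 + 2) * rhoW y := by
        gcongr
        · exact (hN y).trans (by gcongr)
        · exact abs_kpoly_le m y
    _ = _ := by ring

theorem stmt_19 (p q μ β ε K₀ : ℝ) (hp : 3 < p)
    (hq1 : (p + 1) / 2 < q) (hq2 : q < p)
    (hβ1 : 1 / (q - 1) < β) (hβ2 : β < 2 / (p - 1))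
    (hε0 : 0 < ε) (hε1 : ε < min 1 ((p - 1) / 4)) (hK₀ : 1 ≤ K₀)
    (χ₀ : ℝ → ℝ) (hχ : ContDiff ℝ (⊤ : ℕ∞) χ₀) (hχ01 : ∀ z, 0 ≤ χ₀ z ∧ χ₀ z ≤ 1)
    (hχ1 : ∀ z ∈ Set.Icc (-1 : ℝ) 1, χ₀ z = 1)
    (hχsupp : Function.support χ₀ ⊆ Set.Icc (-2 : ℝ) 2) :
    ∀ A ≥ (1 : ℝ), ∃ s₅ ≥ (1 : ℝ), ∃ C > (0 : ℝ), ∀ s ≥ s₅,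
      ∀ v : ℝ → ℝ, ContDiff ℝ 1 v →
      (∀ y, (1 + |y| ^ β) * |v y| ≤ A ^ 2 * s ^ (-((1 - β) / 2))) →
      (∀ y, |deriv v y| ≤ A ^ 2 * s ^ (-(1 / 2) : ℝ)) →
      (∀ y, (1 + |y| ^ β) * |deriv v y| ≤ A ^ 2 * s ^ (-((1 - β) / 2))) →
      -- (i)
      (∀ m ≤ 2, |NtermProj p q μ ε χ₀ v s m| ≤
        C * Real.exp (-((p - q) / (p - 1)) * s / 2)) ∧
      -- (ii)
      (∀ y : ℝ, |NtermMinus p q μ ε K₀ χ₀ v s y| ≤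
        C * Real.exp (-((p - q) / (p - 1)) * s / 2) * (1 + |y| ^ 3)) := by
  intro A hA
  obtain ⟨M, hM0, hM⟩ := exists_phi1_bound hp hε0 hχ hχ01 hχsupp
  set J := ∫ y : ℝ, (y ^ 2 + 2) ^ 2 * rhoW y
  have hJ : 0 ≤ J := integral_nonneg fun y => mul_nonneg (by positivity) (rhoW_nonneg y)
  set K := |μ| * (A ^ 2 + M) * (A ^ 2 + M) ^ (q - 1) * 2
  have hK : 0 ≤ K := by positivity
  refine ⟨1, le_rfl, K * (1 + 9 * J) + 1, by positivity, ?_⟩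
  intro s hs v _ hv hdv _
  have hβ : β < 1 := hβ2.trans_le (by rw [div_le_one (by linarith)]; linarith)
  have hvA (y : ℝ) : |v y| ≤ A ^ 2 := by
    have h1 : s ^ (-((1 - β) / 2)) ≤ 1 := Real.rpow_le_one_of_one_le_of_nonpos hs (by linarith)
    have h2 : 0 ≤ |y| ^ β := by positivity
    nlinarith [hv y, mul_nonneg h2 (abs_nonneg (v y)), mul_le_mul_of_nonneg_left h1 (sq_nonneg A)]
  have hdvA (y : ℝ) : |deriv v y| ≤ A ^ 2 := by
    have h1 : s ^ (-(1 / 2) : ℝ) ≤ 1 := Real.rpow_le_one_of_one_le_of_nonpos hs (by norm_num)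
    nlinarith [hdv y, mul_le_mul_of_nonneg_left h1 (sq_nonneg A)]
  set E := Real.exp (-((p - q) / (p - 1)) * s)
  have hN (y : ℝ) : |Nterm p q μ ε χ₀ v s y| ≤ K * E * |y| :=
    abs_Nterm_le (by linarith)
      (fun y => (abs_add_le _ _).trans (add_le_add (hvA y) (hM s hs y).1))
      (fun y => (abs_add_le _ _).trans (add_le_add (hdvA y) (hM s hs y).2)) y
  have hE0 : 0 < E := Real.exp_pos _
  have hE : E ≤ Real.exp (-((p - q) / (p - 1)) * s / 2) := by
    have h1 : 0 ≤ (p - q) / (p - 1) * s :=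
      mul_nonneg (div_nonneg (by linarith) (by linarith)) (by linarith)
    exact Real.exp_le_exp.mpr (by linarith)
  have hproj (m : ℕ) : |NtermProj p q μ ε χ₀ v s m| ≤ K * E * J :=
    abs_NtermProj_le (by positivity) hN m
  have hKJ : 0 ≤ K * J := by positivity
  refine ⟨fun m _ => ?_, fun y => ?_⟩
  · calc _ ≤ (K * J) * E := (hproj m).trans_eq (by ring)
      _ ≤ _ := by gcongr; linarith
  · have hterm (m : ℕ) : |NtermProj p q μ ε χ₀ v s m * hpoly m y| ≤
        K * E * J * (y ^ 2 + 2) := by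
      rw [abs_mul]
      gcongr
      exacts [hproj m, abs_hpoly_le m y]
    have hsum : |∑ m ∈ Finset.range 3, NtermProj p q μ ε χ₀ v s m * hpoly m y| ≤
        3 * (K * E * J * (y ^ 2 + 2)) := by
      refine (Finset.abs_sum_le_sum_abs _ _).trans ?_
      refine (Finset.sum_le_sum fun m _ => hterm m).trans_eq ?_
      simp
    have hcut : |χ₀ (|y| / (K₀ * √s)) * Nterm p q μ ε χ₀ v s y| ≤ K * E * |y| := by
      rw [abs_mul, abs_of_nonneg (hχ01 _).1]
      exact (mul_le_of_le_one_left (abs_nonneg _) (hχ01 _).2).trans (hN y)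
    have ht := abs_nonneg y
    have hy1 : |y| ≤ 1 + |y| ^ 3 := by
      nlinarith [mul_nonneg ht (sq_nonneg (|y| - 1)), sq_nonneg (|y| - 1)]
    have hy2 : y ^ 2 + 2 ≤ 3 * (1 + |y| ^ 3) := by
      rw [← sq_abs]
      nlinarith [mul_nonneg ht (sq_nonneg (|y| - 1)), sq_nonneg (|y| - 1), pow_nonneg ht 3]
    calc _ ≤ K * E * |y| + 3 * (K * E * J * (y ^ 2 + 2)) :=
          (abs_sub _ _).trans (add_le_add hcut hsum)
      _ ≤ K * E * (1 + |y| ^ 3) + 3 * (K * E * J * (3 * (1 + |y| ^ 3))) := by gcongr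
      _ = K * (1 + 9 * J) * E * (1 + |y| ^ 3) := by ring
      _ ≤ _ := by gcongr; linarith
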